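/- Assume n < q. Then for every β ∈ W and l ∈ ℤ, N_l(β) equals the O_E-span of the polynomials (π^{-l})^{n−i}(u − π^{-l}b)^i for 0 ≤ i ≤ n, where b ∈ F is any lift of β. -/

import Mathlib

open scoped Classical

noncomputable section

namespace BS

variable (E : Type) [Field E]

/-- The ring of integers of a subfield `F` of `E`, with respect to a nonarchimedean
absolute value on `E`, as an additive subgroup of `F`. -/
def OFadd (abs : AbsoluteValue E ℝ)
    (na : ∀ x y : E, abs (x + y) ≤ max (abs x) (abs y))
    (F : Subfield E) : AddSubgroup F where
  carrier := {x | abs (x : E) ≤ 1}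
  zero_mem' := by simp
  add_mem' := by
    intro a b ha hb
    simp only [Set.mem_setOf_eq] at *
    have h : ((a + b : F) : E) = (a : E) + (b : E) := by push_cast; ring
    rw [h]
    exact le_trans (na _ _) (max_le ha hb)
  neg_mem' := by
    intro a ha
    simp only [Set.mem_setOf_eq] at *
    have h : ((-a : F) : E) = -(a : E) := by push_cast; ring
    rw [h, abs.map_neg]
    exact ha

/-- `W = F/O_F`. -/
abbrev Wq (abs : AbsoluteValue E ℝ)
    (na : ∀ x y : E, abs (x + y) ≤ max (abs x) (abs y))
    (F : Subfield E) : Type := F ⧸ OFadd E abs na F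

/-- The canonical projection `F → W = F/O_F`. -/
def mkW (abs : AbsoluteValue E ℝ)
    (na : ∀ x y : E, abs (x + y) ≤ max (abs x) (abs y))
    (F : Subfield E) : F →+ Wq E abs na F := QuotientAddGroup.mk' _

/-- Multiplication by `π` on `W = F/O_F`. -/
def pmulW (abs : AbsoluteValue E ℝ)
    (na : ∀ x y : E, abs (x + y) ≤ max (abs x) (abs y))
    (F : Subfield E) (π : F) (hπ : abs (π : E) ≤ 1) :
    Wq E abs na F →+ Wq E abs na F :=
  QuotientAddGroup.map _ _ (AddMonoidHom.mulLeft π) (by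
    intro x hx
    simp only [AddSubgroup.mem_comap, AddMonoidHom.coe_mulLeft]
    show abs ((π * x : F) : E) ≤ 1
    have h : ((π * x : F) : E) = (π : E) * (x : E) := by push_cast; ring
    rw [h, abs.map_mul]
    have hx' : abs (x : E) ≤ 1 := hx
    nlinarith [abs.nonneg (x : E), abs.nonneg (π : E)])


/-- The lattice `N_l(β) = {P ∈ E[u]^{≤n} : |P(u)| ≤ |π|^{-nl} for all u ∈ D_l(β)}`, where
`D_l(β) = {u ∈ F : |u − π^{-l}b| ≤ |π^{-l}|}` for any lift `b ∈ F` of `β`. -/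
def Nset (abs : AbsoluteValue E ℝ)
    (na : ∀ x y : E, abs (x + y) ≤ max (abs x) (abs y))
    (F : Subfield E) (π : F) (n : ℕ) (l : ℤ) (β : Wq E abs na F) : Set (Polynomial E) :=
  {P | P.degree ≤ (n : WithBot ℕ) ∧ ∀ b : F, mkW E abs na F b = β → ∀ u : F,
      abs ((u : E) - (π : E) ^ (-l) * (b : E)) ≤ abs ((π : E) ^ (-l)) →
      abs (Polynomial.eval (u : E) P) ≤ abs (π : E) ^ (-((n : ℤ) * l))}

/-- The ring of integers of a nonarchimedean absolute value. -/
def integers {E : Type} [Field E] (abs : AbsoluteValue E ℝ)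
    (na : ∀ x y : E, abs (x + y) ≤ max (abs x) (abs y)) : Subring E where
  carrier := {x | abs x ≤ 1}
  zero_mem' := by simp
  one_mem' := by simp
  add_mem' := fun ha hb => (na _ _).trans (max_le ha hb)
  mul_mem' := by
    intro a b ha hb
    simp only [Set.mem_ofPred_eq, map_mul] at *
    exact mul_le_one₀ ha (abs.nonneg b) hb
  neg_mem' := by
    intro a ha
    simpa only [Set.mem_ofPred_eq, abs.map_neg] using ha

theorem mem_integers {E : Type} [Field E] (abs : AbsoluteValue E ℝ)
    (na : ∀ x y : E, abs (x + y) ≤ max (abs x) (abs y)) {x : E} :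
    x ∈ integers abs na ↔ abs x ≤ 1 := Iff.rfl

theorem mem_lifts_subtype_iff {R : Type*} [Ring R] (S : Subring R) (p : Polynomial R) :
    p ∈ Polynomial.lifts S.subtype ↔ ∀ k, p.coeff k ∈ S := by
  simp [Polynomial.lifts_iff_coeff_lifts]

theorem C_mem_lifts_subtype {R : Type*} [Ring R] {S : Subring R} {x : R} (hx : x ∈ S) :
    Polynomial.C x ∈ Polynomial.lifts S.subtype :=
  Polynomial.C_mem_lifts S.subtype ⟨x, hx⟩

/-- A polynomial taking integral values at more points than its degree, the points being integral
with distinct reductions, has integral coefficients. -/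
theorem abs_coeff_le_one_of_abs_eval_le_one {E ι : Type} [Field E] (abs : AbsoluteValue E ℝ)
    (na : ∀ x y : E, abs (x + y) ≤ max (abs x) (abs y)) (s : Finset ι) (v : ι → E)
    (hv : ∀ i ∈ s, abs (v i) ≤ 1) (hvv : ∀ i ∈ s, ∀ j ∈ s, i ≠ j → abs (v i - v j) = 1)
    (Q : Polynomial E) (hdeg : Q.degree < s.card)
    (hQ : ∀ i ∈ s, abs (Q.eval (v i)) ≤ 1) (k : ℕ) : abs (Q.coeff k) ≤ 1 := by
  have hinj : Set.InjOn v s := by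
    intro i hi j hj hij
    by_contra hne
    have := hvv i hi j hj hne
    simp [hij] at this
  rw [← mem_integers abs na]
  refine (mem_lifts_subtype_iff _ _).1 ?_ k
  rw [Lagrange.eq_interpolate hinj hdeg, Lagrange.interpolate_apply]
  refine sum_mem fun i hi => mul_mem (C_mem_lifts_subtype (hQ i hi)) (prod_mem fun j hj => ?_)
  obtain ⟨hji, hj⟩ := Finset.mem_erase.1 hj
  refine mul_mem (C_mem_lifts_subtype ?_) ?_
  · rw [mem_integers, map_inv₀, hvv i hi j hj hji.symm, inv_one]
  · rw [sub_eq_add_neg, ← Polynomial.C_neg]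
    exact add_mem (Polynomial.X_mem_lifts _) (C_mem_lifts_subtype (neg_mem (hv j hj)))

theorem mkW_eq_mkW_iff {E : Type} [Field E] (abs : AbsoluteValue E ℝ)
    (na : ∀ x y : E, abs (x + y) ≤ max (abs x) (abs y)) (F : Subfield E) {b c : F} :
    mkW E abs na F b = mkW E abs na F c ↔ abs ((b : E) - c) ≤ 1 := by
  rw [← sub_eq_zero, ← map_sub]
  exact (QuotientAddGroup.eq_zero_iff (N := OFadd E abs na F) (b - c)).trans Iff.rfl

theorem pmulW_mkW_eq_zero_iff {E : Type} [Field E] (abs : AbsoluteValue E ℝ)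
    (na : ∀ x y : E, abs (x + y) ≤ max (abs x) (abs y)) (F : Subfield E) (π : F)
    (hπ : abs (π : E) ≤ 1) {b : F} :
    pmulW E abs na F π hπ (mkW E abs na F b) = 0 ↔ abs ((π : E) * b) ≤ 1 :=
  (QuotientAddGroup.eq_zero_iff (N := OFadd E abs na F) (π * b)).trans Iff.rfl

/-- The kernel of multiplication by the uniformizer on `F/O_F` has a system of representatives
which, multiplied by the uniformizer, is integral with distinct reductions. -/
theorem exists_integral_representatives {E : Type} [Field E] (abs : AbsoluteValue E ℝ)
    (na : ∀ x y : E, abs (x + y) ≤ max (abs x) (abs y)) (F : Subfield E) (π : F)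
    (hπ0 : π ≠ 0) (hπ1 : abs (π : E) < 1)
    (hdisc : ∀ x : F, x ≠ 0 → ∃ k : ℤ, abs (x : E) = abs (π : E) ^ k) :
    ∃ v : {β : Wq E abs na F // pmulW E abs na F π hπ1.le β = 0} → F,
      (∀ i, abs (v i : E) ≤ 1) ∧ ∀ i j, i ≠ j → abs ((v i : E) - v j) = 1 := by
  have hπpos : 0 < abs (π : E) := abs.pos (by simpa using hπ0)
  have hsurj : Function.Surjective (mkW E abs na F) := QuotientAddGroup.mk'_surjective _
  choose r hr using hsurj
  have hint : ∀ i : {β : Wq E abs na F // pmulW E abs na F π hπ1.le β = 0},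
      abs ((π : E) * r i) ≤ 1 := fun i => by
    rw [← pmulW_mkW_eq_zero_iff abs na F π hπ1.le, hr]
    exact i.2
  refine ⟨fun i => π * r i, fun i => by simpa using hint i, fun i j hij => ?_⟩
  have hfar : 1 < abs ((r i : E) - r j) := by
    by_contra! h
    rw [← mkW_eq_mkW_iff abs na F, hr, hr] at h
    exact hij (Subtype.ext h)
  have hne : π * (r i - r j) ≠ 0 := by
    refine mul_ne_zero hπ0 fun h => ?_
    have h' : (r i : E) - r j = 0 := by exact_mod_cast congrArg Subtype.val h
    rw [h', map_zero] at hfar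
    linarith
  obtain ⟨k, hk⟩ := hdisc _ hne
  push_cast at hk ⊢
  rw [← mul_sub]
  refine le_antisymm ?_ ?_
  · rw [mul_sub]
    exact (integers abs na).sub_mem (hint i) (hint j)
  · rw [hk]
    refine one_le_zpow_of_nonpos₀ hπpos hπ1.le ?_
    have hlt : abs (π : E) ^ (1 : ℤ) < abs (π : E) ^ k := by
      rw [← hk, map_mul, zpow_one]
      exact lt_mul_of_one_lt_right hπpos hfar
    have := (zpow_lt_zpow_iff_right_of_lt_one₀ hπpos hπ1).1 hlt
    omega

/-- Expansion of `P` around `c` in terms of the coefficients of its rescaling by `a`. -/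
theorem eq_sum_coeff_rescale {E : Type} [Field E] {a : E} (ha : a ≠ 0) (c : E) {n : ℕ}
    {P : Polynomial E} (hP : P.natDegree ≤ n) :
    P = ∑ i : Fin (n + 1),
      (Polynomial.C (a ^ n)⁻¹ * P.comp (Polynomial.C a * Polynomial.X + Polynomial.C c)).coeff i •
        (Polynomial.C a ^ (n - (i : ℕ)) * (Polynomial.X - Polynomial.C c) ^ (i : ℕ)) := by
  set Q := P.comp (Polynomial.C a * Polynomial.X + Polynomial.C c) with hQ
  have hdeg : Q.natDegree < n + 1 := by
    rw [hQ, Polynomial.natDegree_comp, Polynomial.natDegree_linear ha]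
    omega
  have hcomp : P = Q.comp (Polynomial.C a⁻¹ * (Polynomial.X - Polynomial.C c)) := by
    rw [hQ, Polynomial.comp_assoc]
    have : (Polynomial.C a * Polynomial.X + Polynomial.C c).comp
        (Polynomial.C a⁻¹ * (Polynomial.X - Polynomial.C c)) = Polynomial.X := by
      simp only [Polynomial.add_comp, Polynomial.mul_comp, Polynomial.C_comp, Polynomial.X_comp]
      rw [← mul_assoc, ← Polynomial.C_mul, mul_inv_cancel₀ ha]
      simp
    rw [this, Polynomial.comp_X]
  conv_lhs => rw [hcomp, Polynomial.as_sum_range_C_mul_X_pow' Q hdeg]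
  rw [Polynomial.sum_comp, Finset.sum_range]
  refine Finset.sum_congr rfl fun i _ => ?_
  have hi : (a ^ n)⁻¹ * a ^ (n - (i : ℕ)) = a⁻¹ ^ (i : ℕ) := by
    have : a ^ n = a ^ (n - (i : ℕ)) * a ^ (i : ℕ) := by
      rw [← pow_add]
      congr 1
      omega
    rw [this, mul_inv, mul_right_comm, inv_mul_cancel₀ (pow_ne_zero _ ha), one_mul, inv_pow]
  rw [Polynomial.coeff_C_mul, Polynomial.smul_eq_C_mul, Polynomial.mul_comp, Polynomial.C_comp,
    Polynomial.X_pow_comp, mul_pow, ← Polynomial.C_pow, ← Polynomial.C_pow, ← hi]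
  simp only [Polynomial.C_mul]
  ring

/-- assume `n < q`.  Then for every `β ∈ W` and `l ∈ ℤ`, `N_l(β)` equals the
`O_E`-span of the polynomials `(π^{-l})^{n−i}(u − π^{-l}b)^i`, `0 ≤ i ≤ n`, where `b ∈ F` is
any lift of `β` (Lemma 2.2(ii) of the paper). -/
theorem stmt9 [CharZero E]
    (abs : AbsoluteValue E ℝ)
    (na : ∀ x y : E, abs (x + y) ≤ max (abs x) (abs y))
    (F : Subfield E) (π : F)
    (hπ0 : π ≠ 0) (hπ1 : abs (π : E) < 1)
    (hdisc : ∀ x : F, x ≠ 0 → ∃ k : ℤ, abs (x : E) = abs (π : E) ^ k)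
    -- the residue field has `q` elements
    (q : ℕ) (hq : 0 < q)
    (hcard : ∀ γ : Wq E abs na F,
      Nat.card {β : Wq E abs na F // pmulW E abs na F π hπ1.le β = γ} = q)
    (n : ℕ) (hn : n < q) :
    ∀ (β : Wq E abs na F) (l : ℤ) (b : F), mkW E abs na F b = β →
      Nset E abs na F π n l β =
        {P : Polynomial E | ∃ c : Fin (n+1) → E, (∀ i, abs (c i) ≤ 1) ∧
          P = ∑ i : Fin (n+1), c i •
            (Polynomial.C ((π : E) ^ (-l)) ^ (n - (i : ℕ)) *
              (Polynomial.X - Polynomial.C ((π : E) ^ (-l) * (b : E))) ^ (i : ℕ))} := by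
  intro β l b hb
  have hπE : (π : E) ≠ 0 := by simpa using hπ0
  set a : E := (π : E) ^ (-l) with ha_def
  have ha_coe : ((π ^ (-l) : F) : E) = a := map_zpow₀ F.subtype π (-l)
  have ha : a ≠ 0 := zpow_ne_zero _ hπE
  have hbound : abs (π : E) ^ (-((n : ℤ) * l)) = abs a ^ n := by
    rw [ha_def, map_zpow₀, ← zpow_natCast, ← zpow_mul]
    congr 1
    ring
  ext P
  constructor
  · rintro ⟨hdeg, hP⟩
    refine ⟨_, ?_, eq_sum_coeff_rescale ha (a * b) (Polynomial.natDegree_le_of_degree_le hdeg)⟩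
    obtain ⟨v, hv, hvv⟩ := exists_integral_representatives abs na F π hπ0 hπ1 hdisc
    have hq0 := hcard 0
    have : Finite {β : Wq E abs na F // pmulW E abs na F π hπ1.le β = 0} :=
      Nat.finite_of_card_ne_zero (by omega)
    have := Fintype.ofFinite {β : Wq E abs na F // pmulW E abs na F π hπ1.le β = 0}
    refine fun i => abs_coeff_le_one_of_abs_eval_le_one abs na Finset.univ (fun j => (v j : E))
      (fun j _ => hv j) (fun j _ k _ => hvv j k) _ ?_ (fun j _ => ?_) i
    · rw [Finset.card_univ, ← Nat.card_eq_fintype_card, hq0]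
      refine Polynomial.degree_le_natDegree.trans_lt ?_
      rw [Polynomial.natDegree_C_mul (inv_ne_zero (pow_ne_zero n ha)), Polynomial.natDegree_comp,
        Polynomial.natDegree_linear ha, mul_one]
      exact_mod_cast (Polynomial.natDegree_le_of_degree_le hdeg).trans_lt hn
    · have h := hP b hb (π ^ (-l) * (v j + b)) (by
        push_cast
        rw [ha_coe, ← mul_sub, add_sub_cancel_right, map_mul]
        exact mul_le_of_le_one_right (abs.nonneg a) (hv j))
      push_cast at h
      rw [ha_coe, hbound, mul_add] at h
      simp only [Polynomial.eval_mul, Polynomial.eval_C, Polynomial.eval_comp,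
        Polynomial.eval_add, Polynomial.eval_X, map_mul, map_inv₀, map_pow]
      exact inv_mul_le_one_of_le₀ h (pow_nonneg (abs.nonneg a) n)
  · rintro ⟨c, hc, rfl⟩
    refine ⟨?_, fun b' hb' u hu => ?_⟩
    · rw [← Polynomial.natDegree_le_iff_degree_le]
      refine Polynomial.natDegree_sum_le_of_forall_le _ _ fun i _ => ?_
      refine (Polynomial.natDegree_smul_le _ _).trans ?_
      rw [← Polynomial.C_pow]
      refine (Polynomial.natDegree_C_mul_le _ _).trans ?_
      rw [Polynomial.natDegree_pow, Polynomial.natDegree_X_sub_C]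
      omega
    · have hbb : abs ((b' : E) - b) ≤ 1 := (mkW_eq_mkW_iff abs na F).1 (hb'.trans hb.symm)
      have hu' : abs ((u : E) - a * b) ≤ abs a := by
        have : (u : E) - a * b = (u - a * b') + a * (b' - b) := by ring
        rw [this]
        refine (na _ _).trans (max_le hu ?_)
        rw [map_mul]
        exact mul_le_of_le_one_right (abs.nonneg a) hbb
      rw [hbound, Polynomial.eval_finsetSum]
      refine (IsNonarchimedean.apply_sum_le_sup (f := abs) na
        Finset.univ_nonempty).trans (Finset.sup'_le _ _ fun i _ => ?_)
      simp only [Polynomial.eval_smul, Polynomial.eval_mul, Polynomial.eval_pow,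
        Polynomial.eval_C, Polynomial.eval_sub, Polynomial.eval_X, smul_eq_mul, map_mul, map_pow]
      calc abs (c i) * (abs a ^ (n - (i : ℕ)) * abs ((u : E) - a * b) ^ (i : ℕ))
          ≤ 1 * (abs a ^ (n - (i : ℕ)) * abs a ^ (i : ℕ)) := by
            gcongr
            exact hc i
        _ = abs a ^ n := by
            rw [one_mul, ← pow_add]
            congr 1
            omega

end BS
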